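/- Let r ≥ 1 and N ≥ 2r + 1. Let φ_m be a left-toggle radius-r local rule and let φ_b be a radius-r local rule for which there exists g : Bool → Bool with g = id or g = not such that φ_b(v) = g(v(0)) for every neighborhood v. Then the hybrid global map Φ determined by φ_m and φ_b is surjective on configurations ZMod N → Bool: every configuration s has at least one pre-image t with Φ(t) = s. -/

import Mathlib

/-- The radius-`r` neighborhood of cell `i` in configuration `s` on a cyclic
lattice of `N` cells: position `j` holds the value of cell `i + j - r`. -/
def nbhd (N r : ℕ) (s : ZMod N → Bool) (i : ZMod N) : Fin (2*r+1) → Bool :=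
  fun j => s (i + ((j : ℕ) : ZMod N) - ((r : ℕ) : ZMod N))

/-- A radius-`r` local rule is left-toggle if two neighborhoods agreeing
everywhere except at position 0 (the leftmost cell) get different outputs. -/
def LeftToggle (r : ℕ) (f : (Fin (2*r+1) → Bool) → Bool) : Prop :=
  ∀ v w : Fin (2*r+1) → Bool,
    (∀ j, j ≠ 0 → v j = w j) → v 0 ≠ w 0 → f v ≠ f w

/-- A radius-`r` local rule is right-toggle if two neighborhoods agreeing
everywhere except at position `2r` (the rightmost cell) get different outputs. -/
def RightToggle (r : ℕ) (f : (Fin (2*r+1) → Bool) → Bool) : Prop :=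
  ∀ v w : Fin (2*r+1) → Bool,
    (∀ j, j ≠ Fin.last (2*r) → v j = w j) →
      v (Fin.last (2*r)) ≠ w (Fin.last (2*r)) → f v ≠ f w

/-- The hybrid global map: cells `0, …, 2r-1` (the border) are updated with
the border rule `φb`, all other cells with the main rule `φm`. -/
def hybrid (N r : ℕ) (φm φb : (Fin (2*r+1) → Bool) → Bool)
    (s : ZMod N → Bool) : ZMod N → Bool :=
  fun i => if i.val < 2*r then φb (nbhd N r s i) else φm (nbhd N r s i)

theorem LeftToggle.apply_zero_eq {r : ℕ} {f : (Fin (2*r+1) → Bool) → Bool}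
    (hf : LeftToggle r f) {v w : Fin (2*r+1) → Bool}
    (hvw : ∀ j, j ≠ 0 → v j = w j) (h : f v = f w) : v 0 = w 0 :=
  not_not.mp fun h0 => hf v w hvw h0 h

/-- If the border rule determines the leftmost cell of a neighborhood and the main rule is
left-toggle, the hybrid global map is injective: the border fixes `2r` consecutive cells, and
the remaining ones are then determined from right to left. -/
theorem hybrid_injective {r N : ℕ} [NeZero N] {φm φb : (Fin (2*r+1) → Bool) → Bool}
    (hN : 2*r ≤ N) (hm : LeftToggle r φm)
    (hb : ∀ v w : Fin (2*r+1) → Bool, φb v = φb w → v 0 = w 0) :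
    Function.Injective (hybrid N r φm φb) := by
  intro t u h
  have border : ∀ k < 2*r, k < N → t ((k : ZMod N) - r) = u ((k : ZMod N) - r) := by
    intro k hk hkN
    have hk' := congrFun h (k : ZMod N)
    simp only [hybrid, ZMod.val_cast_of_lt hkN, if_pos hk] at hk'
    simpa [nbhd] using hb _ _ hk'
  have key : ∀ d k : ℕ, k + d + 1 = N + 2*r →
      t ((k : ZMod N) - r) = u ((k : ZMod N) - r) := by
    intro d
    induction d using Nat.strong_induction_on with
    | _ d ih =>
      intro k hkd
      rcases lt_or_ge k N with hkN | hkN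
      · rcases lt_or_ge k (2*r) with hk | hk
        · exact border k hk hkN
        · have hk' := congrFun h (k : ZMod N)
          simp only [hybrid, ZMod.val_cast_of_lt hkN, if_neg hk.not_gt] at hk'
          have hzero := hm.apply_zero_eq (fun j hj => by
            have hj0 : (j : ℕ) ≠ 0 := Fin.val_ne_zero_iff.mpr hj
            have hjr := j.isLt
            simpa [nbhd] using ih (d - j) (by omega) (k + j) (by omega)) hk'
          simpa [nbhd] using hzero
      · have hk := border (k - N) (by omega) (by omega)
        simpa [Nat.cast_sub hkN] using hk
  funext x
  have hx := key (N + 2*r - (x + r).val - 1) (x + r).val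
    (by have := ZMod.val_lt (x + (r : ZMod N)); omega)
  simpa using hx

/-- for `r ≥ 1` and `N ≥ 2r+1`, with a left-toggle main rule
and a border rule that always copies or always complements the leftmost input
bit, the hybrid global map is surjective (at least one pre-image). -/
theorem hca_surjective
    (r N : ℕ) (hr : 1 ≤ r) (hN : 2*r+1 ≤ N)
    (φm φb : (Fin (2*r+1) → Bool) → Bool)
    (hm : LeftToggle r φm)
    (g : Bool → Bool) (hg : g = id ∨ g = not)
    (hb : ∀ v : Fin (2*r+1) → Bool, φb v = g (v 0)) :
    Function.Surjective (hybrid N r φm φb) := by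
  have : NeZero N := ⟨by omega⟩
  refine Finite.injective_iff_surjective.mp (hybrid_injective (by omega) hm fun v w h => ?_)
  rw [hb, hb] at h
  rcases hg with rfl | rfl
  · exact h
  · exact Bool.not_inj h
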